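/- arXiv:math/9910085 — 2 statements merged into one kernel-verified Lean document; each statement's English description precedes it below -/
import Mathlib

section
/- Let ω be the standard symplectic form on ℤ^{2g} with basis α₁, …, α_g, β₁, …, β_g, and for γ ∈ ℤ^{2g} let t_γ denote the transvection t_γ(x) = ω(γ, x)·γ + x. Define, for i ≠ j, μ_{ij} = t_{α_i} ∘ t_{α_j} ∘ t_{α_i + α_j}⁻¹, η_{ij} = t_{β_i} ∘ t_{β_j} ∘ t_{β_i + β_j}⁻¹, and ν_{ij} = t_{α_i} ∘ t_{β_j} ∘ t_{α_i + β_j}⁻¹. Then the elements t_{α_i}, t_{β_i} (i = 1, …, g) together with μ_{ij}, η_{ij}, ν_{ij} (i ≠ j = 1, …, g) generate the symplectic group Sp_{2g}(ℤ). -/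
/-! Common definitions: the standard symplectic form `ω` on `ℤ^{2g}` with basis
`α₁, …, α_g, β₁, …, β_g` (indexed by `Fin g ⊕ Fin g`), transvections, and the
elements `μ_{ij}`, `η_{ij}`, `ν_{ij}`. -/

open Matrix

noncomputable section

/-- The matrix `((0, I), (-I, 0))` of the standard symplectic form `ω` in the basis
`α₁, …, α_g, β₁, …, β_g` of `ℤ^{2g}`. -/
def sympJ (g : ℕ) : Matrix (Fin g ⊕ Fin g) (Fin g ⊕ Fin g) ℤ :=
  Matrix.fromBlocks 0 1 (-1) 0

/-- The standard symplectic form `ω` on `ℤ^{2g}`: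
`ω (αᵢ, βᵢ) = 1`, `ω (αᵢ, αⱼ) = ω (βᵢ, βⱼ) = 0`, `ω (αᵢ, βⱼ) = 0` for `i ≠ j`. -/
def sympForm {g : ℕ} (x y : Fin g ⊕ Fin g → ℤ) : ℤ :=
  x ⬝ᵥ (sympJ g *ᵥ y)

/-- The basis vector `αᵢ` of `ℤ^{2g}`. -/
def alphaV (g : ℕ) (i : Fin g) : Fin g ⊕ Fin g → ℤ := Pi.single (Sum.inl i) 1

/-- The basis vector `βᵢ` of `ℤ^{2g}`. -/
def betaV (g : ℕ) (i : Fin g) : Fin g ⊕ Fin g → ℤ := Pi.single (Sum.inr i) 1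

/-- The transvection `t_γ : x ↦ ω(γ, x)·γ + x` along `γ ∈ ℤ^{2g}`, as a matrix. -/
def transvection {g : ℕ} (γ : Fin g ⊕ Fin g → ℤ) :
    Matrix (Fin g ⊕ Fin g) (Fin g ⊕ Fin g) ℤ :=
  1 + Matrix.vecMulVec γ (γ ᵥ* sympJ g)

/-- The map `x ↦ -ω(γ, x)·γ + x` (the inverse of the transvection `t_γ`). -/
def transvectionInv {g : ℕ} (γ : Fin g ⊕ Fin g → ℤ) :
    Matrix (Fin g ⊕ Fin g) (Fin g ⊕ Fin g) ℤ :=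
  1 - Matrix.vecMulVec γ (γ ᵥ* sympJ g)

/-- `μ_{ij} = t_{αᵢ} ∘ t_{αⱼ} ∘ t_{αᵢ+αⱼ}⁻¹`. -/
def muT (g : ℕ) (i j : Fin g) : Matrix (Fin g ⊕ Fin g) (Fin g ⊕ Fin g) ℤ :=
  transvection (alphaV g i) * transvection (alphaV g j) *
    transvectionInv (alphaV g i + alphaV g j)

/-- `η_{ij} = t_{βᵢ} ∘ t_{βⱼ} ∘ t_{βᵢ+βⱼ}⁻¹`. -/
def etaT (g : ℕ) (i j : Fin g) : Matrix (Fin g ⊕ Fin g) (Fin g ⊕ Fin g) ℤ :=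
  transvection (betaV g i) * transvection (betaV g j) *
    transvectionInv (betaV g i + betaV g j)

/-- `ν_{ij} = t_{αᵢ} ∘ t_{βⱼ} ∘ t_{αᵢ+βⱼ}⁻¹`. -/
def nuT (g : ℕ) (i j : Fin g) : Matrix (Fin g ⊕ Fin g) (Fin g ⊕ Fin g) ℤ :=
  transvection (alphaV g i) * transvection (betaV g j) *
    transvectionInv (alphaV g i + betaV g j)

namespace SympGen

variable {g : ℕ}

/-- The index `i` of the basis vector `αᵢ` or `βᵢ`. -/
def idx (p : Fin g ⊕ Fin g) : Fin g := Sum.elim id id p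

/-- The sign `ω(e_p, e_{p.swap})`. -/
def sgn (p : Fin g ⊕ Fin g) : ℤ := Sum.elim (fun _ => 1) (fun _ => -1) p

@[simp] lemma idx_swap (p : Fin g ⊕ Fin g) : idx p.swap = idx p := by
  cases p <;> rfl

lemma sgn_cases (p : Fin g ⊕ Fin g) : sgn p = 1 ∨ sgn p = -1 := by
  cases p <;> simp [sgn]

lemma swap_ne (p : Fin g ⊕ Fin g) : p.swap ≠ p := by
  cases p <;> simp

lemma eq_or_eq_swap_of_idx_eq {p q : Fin g ⊕ Fin g} (h : idx p = idx q) :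
    q = p ∨ q = p.swap := by
  cases p <;> cases q <;> simp_all [idx]

lemma sympForm_single_left (p : Fin g ⊕ Fin g) (c : ℤ) (x : Fin g ⊕ Fin g → ℤ) :
    sympForm (Pi.single p c) x = c * (sgn p * x p.swap) := by
  cases p <;>
    simp [sympForm, sympJ, sgn, single_dotProduct, Matrix.fromBlocks_mulVec, Matrix.neg_mulVec]

lemma sympForm_add_left (x y z : Fin g ⊕ Fin g → ℤ) :
    sympForm (x + y) z = sympForm x z + sympForm y z := by
  simp [sympForm, add_dotProduct]

lemma sympForm_add_right (x y z : Fin g ⊕ Fin g → ℤ) :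
    sympForm x (y + z) = sympForm x y + sympForm x z := by
  simp [sympForm, Matrix.mulVec_add, dotProduct_add]

lemma sympForm_smul_right (c : ℤ) (x y : Fin g ⊕ Fin g → ℤ) :
    sympForm x (c • y) = c * sympForm x y := by
  rw [sympForm, Matrix.mulVec_smul, dotProduct_smul, smul_eq_mul, sympForm]

lemma sympForm_smul_left (c : ℤ) (x y : Fin g ⊕ Fin g → ℤ) :
    sympForm (c • x) y = c * sympForm x y := by
  rw [sympForm, smul_dotProduct, smul_eq_mul, sympForm]

lemma sympJ_transpose : (sympJ g)ᵀ = -sympJ g := by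
  simp [sympJ, Matrix.fromBlocks_transpose, Matrix.fromBlocks_neg]

lemma J_eq_neg_sympJ : Matrix.J (Fin g) ℤ = -sympJ g := by
  simp [sympJ, Matrix.J, Matrix.fromBlocks_neg]

lemma sympForm_swap (x y : Fin g ⊕ Fin g → ℤ) : sympForm x y = -sympForm y x := by
  unfold sympForm
  rw [Matrix.dotProduct_mulVec, dotProduct_comm, ← Matrix.mulVec_transpose, sympJ_transpose,
    Matrix.neg_mulVec, dotProduct_neg]

lemma sympForm_self (x : Fin g ⊕ Fin g → ℤ) : sympForm x x = 0 := by
  have := sympForm_swap x x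
  lia

lemma transvection_mulVec (γ x : Fin g ⊕ Fin g → ℤ) :
    transvection γ *ᵥ x = x + sympForm γ x • γ := by
  rw [_root_.transvection, Matrix.add_mulVec, Matrix.one_mulVec, Matrix.vecMulVec_mulVec, sympForm,
    Matrix.dotProduct_mulVec]
  simp

lemma transvectionInv_mulVec (γ x : Fin g ⊕ Fin g → ℤ) :
    transvectionInv γ *ᵥ x = x - sympForm γ x • γ := by
  rw [transvectionInv, Matrix.sub_mulVec, Matrix.one_mulVec, Matrix.vecMulVec_mulVec, sympForm,
    Matrix.dotProduct_mulVec]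
  simp

lemma mem_of_sympForm {A : Matrix (Fin g ⊕ Fin g) (Fin g ⊕ Fin g) ℤ}
    (h : ∀ x y, sympForm (A *ᵥ x) (A *ᵥ y) = sympForm x y) :
    A ∈ Matrix.symplecticGroup (Fin g) ℤ := by
  rw [SymplecticGroup.mem_iff', J_eq_neg_sympJ, Matrix.mul_neg, Matrix.neg_mul, neg_inj]
  ext p q
  have := h (Pi.single p 1) (Pi.single q 1)
  simp only [sympForm] at this
  rw [Matrix.mulVec_mulVec, ← Matrix.vecMul_transpose, ← Matrix.dotProduct_mulVec,
    Matrix.mulVec_mulVec, ← Matrix.mul_assoc] at this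
  simpa using this

lemma sympForm_mulVec (A : Matrix.symplecticGroup (Fin g) ℤ) (x y : Fin g ⊕ Fin g → ℤ) :
    sympForm (A.val *ᵥ x) (A.val *ᵥ y) = sympForm x y := by
  have h := SymplecticGroup.mem_iff'.1 A.2
  rw [J_eq_neg_sympJ, Matrix.mul_neg, Matrix.neg_mul, neg_inj] at h
  simp only [sympForm]
  rw [Matrix.mulVec_mulVec, ← Matrix.vecMul_transpose, ← Matrix.dotProduct_mulVec,
    Matrix.mulVec_mulVec, ← Matrix.mul_assoc, h]

lemma transvection_mem (γ : Fin g ⊕ Fin g → ℤ) :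
    transvection γ ∈ Matrix.symplecticGroup (Fin g) ℤ := by
  refine mem_of_sympForm fun x y => ?_
  simp only [transvection_mulVec, sympForm_add_right, sympForm_smul_right,
    sympForm_add_left, sympForm_smul_left, sympForm_self]
  rw [sympForm_swap x γ]
  ring

lemma transvectionInv_mem (γ : Fin g ⊕ Fin g → ℤ) :
    transvectionInv γ ∈ Matrix.symplecticGroup (Fin g) ℤ := by
  refine mem_of_sympForm fun x y => ?_
  simp only [transvectionInv_mulVec, sub_eq_add_neg, ← neg_smul, sympForm_add_right,
    sympForm_smul_right, sympForm_add_left, sympForm_smul_left, sympForm_self]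
  rw [sympForm_swap x γ]
  ring

lemma transvection_mul_mul_mulVec {u v : Fin g ⊕ Fin g → ℤ} (h : sympForm u v = 0)
    (x : Fin g ⊕ Fin g → ℤ) :
    (transvection u * transvection v * transvectionInv (u + v)) *ᵥ x
      = x - sympForm u x • v - sympForm v x • u := by
  have h' : sympForm v u = 0 := by rw [sympForm_swap, h, neg_zero]
  simp only [← Matrix.mulVec_mulVec, transvection_mulVec, transvectionInv_mulVec,
    sub_eq_add_neg, ← neg_smul, sympForm_add_right, sympForm_add_left, sympForm_smul_right,
    sympForm_self, h, h']
  module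

/-- The subgroup generated by the transvections `t_{αᵢ}`, `t_{βᵢ}` and the elements `μ_{ij}`,
`η_{ij}`, `ν_{ij}`. -/
def elemSubgroup (g : ℕ) : Subgroup (Matrix.symplecticGroup (Fin g) ℤ) :=
  Subgroup.closure {x : Matrix.symplecticGroup (Fin g) ℤ |
      (∃ i, x.val = transvection (alphaV g i) ∨ x.val = transvection (betaV g i)) ∨
      (∃ i j, i ≠ j ∧
        (x.val = muT g i j ∨ x.val = etaT g i j ∨ x.val = nuT g i j))}

lemma exists_elem_transvection (p : Fin g ⊕ Fin g) :
    ∃ h ∈ elemSubgroup g, ∀ x, h.val *ᵥ x = x + Pi.single p (sgn p * x p.swap) := by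
  refine ⟨⟨_, transvection_mem (Pi.single p 1)⟩, Subgroup.subset_closure (Or.inl ?_), fun x => ?_⟩
  · rcases p with i | i
    · exact ⟨i, Or.inl rfl⟩
    · exact ⟨i, Or.inr rfl⟩
  · simp [transvection_mulVec, sympForm_single_left, ← Pi.single_smul]

lemma exists_elem_pair {p q : Fin g ⊕ Fin g} (hpq : idx p ≠ idx q) :
    ∃ h ∈ elemSubgroup g, ∀ x, h.val *ᵥ x =
      x - Pi.single q (sgn p * x p.swap) - Pi.single p (sgn q * x q.swap) := by
  have h0 : sympForm (Pi.single p 1 : Fin g ⊕ Fin g → ℤ) (Pi.single q 1) = 0 := by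
    rw [sympForm_single_left, Pi.single_eq_of_ne]
    · simp
    · rintro rfl
      simp at hpq
  have key : ∀ u v : Fin g ⊕ Fin g, transvection (Pi.single u 1) * transvection (Pi.single v 1)
      * transvectionInv (Pi.single u 1 + Pi.single v 1) ∈ Matrix.symplecticGroup (Fin g) ℤ :=
    fun u v => mul_mem (mul_mem (transvection_mem _) (transvection_mem _)) (transvectionInv_mem _)
  have h0' : sympForm (Pi.single q 1 : Fin g ⊕ Fin g → ℤ) (Pi.single p 1) = 0 := by
    rw [sympForm_swap, h0, neg_zero]
  rcases p with i | i <;> rcases q with j | j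
  · refine ⟨⟨_, key (.inl i) (.inl j)⟩,
      Subgroup.subset_closure (Or.inr ⟨i, j, hpq, Or.inl rfl⟩), fun x => ?_⟩
    simp [transvection_mul_mul_mulVec h0, sympForm_single_left, ← Pi.single_smul]
  · refine ⟨⟨_, key (.inl i) (.inr j)⟩,
      Subgroup.subset_closure (Or.inr ⟨i, j, hpq, Or.inr (Or.inr rfl)⟩), fun x => ?_⟩
    simp [transvection_mul_mul_mulVec h0, sympForm_single_left, ← Pi.single_smul]
  · refine ⟨⟨_, key (.inl j) (.inr i)⟩,
      Subgroup.subset_closure (Or.inr ⟨j, i, hpq.symm, Or.inr (Or.inr rfl)⟩), fun x => ?_⟩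
    simp [transvection_mul_mul_mulVec h0', sympForm_single_left, ← Pi.single_smul]
    abel
  · refine ⟨⟨_, key (.inr i) (.inr j)⟩,
      Subgroup.subset_closure (Or.inr ⟨i, j, hpq, Or.inr (Or.inl rfl)⟩), fun x => ?_⟩
    simp [transvection_mul_mul_mulVec h0, sympForm_single_left, ← Pi.single_smul]

/-- The elements of `elemSubgroup g` fixing the basis vectors with index in `P`. -/
def fixing (P : Set (Fin g ⊕ Fin g)) : Subgroup (Matrix.symplecticGroup (Fin g) ℤ) where
  carrier := {h | h ∈ elemSubgroup g ∧ ∀ p ∈ P, h.val *ᵥ Pi.single p 1 = Pi.single p 1}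
  one_mem' := ⟨one_mem _, fun p _ => by rw [Submonoid.coe_one, Matrix.one_mulVec]⟩
  mul_mem' {a b} ha hb := ⟨mul_mem ha.1 hb.1, fun p hp => by
    rw [Submonoid.coe_mul, ← Matrix.mulVec_mulVec, hb.2 p hp, ha.2 p hp]⟩
  inv_mem' {a} ha := ⟨inv_mem ha.1, fun p hp => by
    nth_rw 1 [← ha.2 p hp]
    rw [Matrix.mulVec_mulVec, ← Submonoid.coe_mul, inv_mul_cancel,
      Submonoid.coe_one, Matrix.one_mulVec]⟩

/-- `w` lies in the orbit of `v` under `fixing P`. -/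
def Reach (P : Set (Fin g ⊕ Fin g)) (v w : Fin g ⊕ Fin g → ℤ) : Prop :=
  ∃ h ∈ fixing P, h.val *ᵥ v = w

lemma Reach.refl (P : Set (Fin g ⊕ Fin g)) (v : Fin g ⊕ Fin g → ℤ) : Reach P v v :=
  ⟨1, one_mem _, by simp⟩

lemma Reach.trans {P : Set (Fin g ⊕ Fin g)} {u v w : Fin g ⊕ Fin g → ℤ}
    (h₁ : Reach P u v) (h₂ : Reach P v w) : Reach P u w := by
  obtain ⟨a, ha, rfl⟩ := h₁
  obtain ⟨b, hb, rfl⟩ := h₂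
  exact ⟨b * a, mul_mem hb ha, by rw [Submonoid.coe_mul, ← Matrix.mulVec_mulVec]⟩

lemma Reach.symm {P : Set (Fin g ⊕ Fin g)} {u v : Fin g ⊕ Fin g → ℤ}
    (h : Reach P u v) : Reach P v u := by
  obtain ⟨a, ha, rfl⟩ := h
  exact ⟨a⁻¹, inv_mem ha, by
    rw [Matrix.mulVec_mulVec, ← Submonoid.coe_mul, inv_mul_cancel]; simp⟩

lemma reach_transvection {P : Set (Fin g ⊕ Fin g)} {p : Fin g ⊕ Fin g} (hp : p.swap ∉ P)
    (x : Fin g ⊕ Fin g → ℤ) : Reach P x (x + Pi.single p (sgn p * x p.swap)) := by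
  obtain ⟨h, hh, hx⟩ := exists_elem_transvection p
  refine ⟨h, ⟨hh, fun r hr => ?_⟩, hx x⟩
  rw [hx, Pi.single_eq_of_ne (by rintro rfl; exact hp hr)]
  simp

lemma reach_pair {P : Set (Fin g ⊕ Fin g)} {p q : Fin g ⊕ Fin g} (hpq : idx p ≠ idx q)
    (hp : p.swap ∉ P) (hq : q.swap ∉ P) (x : Fin g ⊕ Fin g → ℤ) :
    Reach P x (x - Pi.single q (sgn p * x p.swap) - Pi.single p (sgn q * x q.swap)) := by
  obtain ⟨h, hh, hx⟩ := exists_elem_pair hpq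
  refine ⟨h, ⟨hh, fun r hr => ?_⟩, hx x⟩
  rw [hx, Pi.single_eq_of_ne (i := r) (i' := p.swap) (by rintro rfl; exact hp hr),
    Pi.single_eq_of_ne (i := r) (i' := q.swap) (by rintro rfl; exact hq hr)]
  simp

/-- The basis vectors outside the pairs `αᵢ, βᵢ` with `i ∈ T`. -/
def outside (T : Finset (Fin g)) : Set (Fin g ⊕ Fin g) := {p | idx p ∉ T}

lemma exists_reach_update {T : Finset (Fin g)} {p q : Fin g ⊕ Fin g} (hp : idx p ∈ T)
    (hq : idx q ∈ T) (hne : p ≠ q) :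
    ∃ s : ℤ, (s = 1 ∨ s = -1) ∧ ∀ v : Fin g ⊕ Fin g → ℤ, (q = p.swap ∨ v p.swap = 0) →
      Reach (outside T) v (Function.update v p (v p + s * v q)) := by
  by_cases hi : idx p = idx q
  · obtain rfl : q = p.swap := (eq_or_eq_swap_of_idx_eq hi).resolve_left hne.symm
    refine ⟨sgn p, sgn_cases p, fun v _ => ?_⟩
    convert reach_transvection (P := outside T) (p := p) (by simpa [outside] using hp) v using 1
    ext r
    by_cases hr : r = p
    · subst hr; simp
    · simp [hr]
  · refine ⟨-sgn q.swap, by rcases sgn_cases q.swap with h | h <;> simp [h], fun v hv => ?_⟩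
    replace hv : v p.swap = 0 := hv.resolve_left (by rintro rfl; simp at hi)
    convert reach_pair (P := outside T) (p := p) (q := q.swap) (by simpa using hi)
      (by simpa [outside] using hp) (by simpa [outside] using hq) v using 1
    ext r
    by_cases hr : r = p
    · subst hr; simp [hv]; ring
    · simp [hr, hv]

lemma reach_update {T : Finset (Fin g)} {p q : Fin g ⊕ Fin g} (hp : idx p ∈ T)
    (hq : idx q ∈ T) (hne : p ≠ q) {v : Fin g ⊕ Fin g → ℤ} (hv : q = p.swap ∨ v p.swap = 0)
    {e : ℤ} (he : e = 1 ∨ e = -1) :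
    Reach (outside T) v (Function.update v p (v p + e * v q)) := by
  obtain ⟨s, hs, h⟩ := exists_reach_update hp hq hne
  by_cases hes : e = s
  · exact hes ▸ h v hv
  · have hes' : e = -s := by lia
    have := h (Function.update v p (v p + e * v q))
      (hv.imp_right fun h0 => by rw [Function.update_of_ne (swap_ne p), h0])
    convert this.symm using 1
    ext r
    by_cases hr : r = p
    · subst hr; simp [hes', hne.symm]
    · simp [hr]

lemma reach_single_of_ne {T : Finset (Fin g)} {p q : Fin g ⊕ Fin g} (hp : idx p ∈ T)
    (hq : idx q ∈ T) (hne : p ≠ q) {c : ℤ} (hc : c = 1 ∨ c = -1) :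
    Reach (outside T) (Pi.single q c) (Pi.single p 1) := by
  have h₁ := reach_update hp hq hne (v := Pi.single q c) (e := c)
    (by by_cases h : q = p.swap
        · exact Or.inl h
        · exact Or.inr (Pi.single_eq_of_ne (Ne.symm h) _)) hc
  refine h₁.trans ?_
  have h₂ := reach_update hq hp hne.symm (e := -c)
    (v := Function.update (Pi.single q c) p ((Pi.single q c : Fin g ⊕ Fin g → ℤ) p
      + c * (Pi.single q c : Fin g ⊕ Fin g → ℤ) q))
    (by by_cases h : p = q.swap
        · exact Or.inl h
        · refine Or.inr ?_
          rw [Function.update_of_ne (Ne.symm h), Pi.single_eq_of_ne (swap_ne q)]) (by lia)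
  convert h₂ using 1
  ext r
  have hcc : c * c = 1 := by rcases hc with rfl | rfl <;> rfl
  by_cases hr : r = q
  · subst hr; simp [hne.symm, hne, hcc]
  · by_cases hr' : r = p
    · subst hr'; simp [hr, hcc]
    · simp [hr, hr']

lemma reach_single {T : Finset (Fin g)} {p q : Fin g ⊕ Fin g} (hp : idx p ∈ T)
    (hq : idx q ∈ T) {c : ℤ} (hc : c = 1 ∨ c = -1) :
    Reach (outside T) (Pi.single q c) (Pi.single p 1) := by
  by_cases hne : p = q
  · subst hne
    exact (reach_single_of_ne (p := p.swap) (by simpa using hp) hp (swap_ne p) hc).trans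
      (reach_single_of_ne hp (by simpa using hp) (swap_ne p).symm (Or.inl rfl))
  · exact reach_single_of_ne hp hq hne hc

lemma sum_update_lt {v : Fin g ⊕ Fin g → ℤ} {p : Fin g ⊕ Fin g} {a : ℤ}
    (h : a.natAbs < (v p).natAbs) :
    ∑ r, (Function.update v p a r).natAbs < ∑ r, (v r).natAbs := by
  refine Finset.sum_lt_sum (fun r _ => ?_) ⟨p, Finset.mem_univ _, by simpa using h⟩
  by_cases hr : r = p
  · subst hr; simpa using h.le
  · simp [hr]

/-- The Euclidean algorithm: a vector supported on `T` is brought to a multiple of a basis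
vector. -/
lemma exists_reach_single {T : Finset (Fin g)} (n : ℕ) :
    ∀ v : Fin g ⊕ Fin g → ℤ, ∑ r, (v r).natAbs = n → (∀ r, idx r ∉ T → v r = 0) → v ≠ 0 →
      ∃ q c, idx q ∈ T ∧ Reach (outside T) v (Pi.single q c) := by
  induction n using Nat.strong_induction_on with
  | _ n ih =>
    intro v hn hT hv
    have hmem : ∀ r, v r ≠ 0 → idx r ∈ T := fun r hr => by_contra fun h => hr (hT r h)
    by_cases hex : ∃ p q, p ≠ q ∧ v p ≠ 0 ∧ v q ≠ 0 ∧ (v q).natAbs ≤ (v p).natAbs ∧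
        (q = p.swap ∨ v p.swap = 0)
    · obtain ⟨p, q, hne, hp, hq, hle, hc⟩ := hex
      obtain ⟨e, he, hlt⟩ : ∃ e : ℤ, (e = 1 ∨ e = -1) ∧
          (v p + e * v q).natAbs < (v p).natAbs := by
        by_cases hs : (v p + 1 * v q).natAbs < (v p).natAbs
        · exact ⟨1, Or.inl rfl, hs⟩
        · exact ⟨-1, Or.inr rfl, by lia⟩
      have hr := reach_update (hmem p hp) (hmem q hq) hne hc he
      obtain ⟨q', c, hq', hr'⟩ := ih _ (hn ▸ sum_update_lt hlt) _ rfl (fun r hrT => by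
          rw [Function.update_of_ne (by rintro rfl; exact hrT (hmem _ hp)), hT r hrT])
        (fun h0 => hq (by
          have := congrFun h0 q
          rwa [Function.update_of_ne hne.symm] at this))
      exact ⟨q', c, hq', hr.trans hr'⟩
    · push Not at hex
      obtain ⟨p, hp⟩ := Function.ne_iff.1 hv
      have huniq : ∀ p q, p ≠ q → v p ≠ 0 → v q ≠ 0 → (v q).natAbs ≤ (v p).natAbs → False := by
        intro p q hne hp hq hle
        have hs := (hex p q hne hp hq hle).2
        rcases le_total (v p).natAbs (v p.swap).natAbs with h | h
        · exact (hex p.swap p (swap_ne p) hs hp h).1 (by simp)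
        · exact (hex p p.swap (swap_ne p).symm hp hs h).1 rfl
      refine ⟨p, v p, hmem p hp, ?_⟩
      convert Reach.refl (outside T) v using 1
      ext r
      by_cases hr : r = p
      · subst hr; simp
      · rw [Pi.single_eq_of_ne hr]
        by_contra h0
        rcases le_total (v p).natAbs (v r).natAbs with h | h
        · exact huniq r p hr (Ne.symm h0) hp h
        · exact huniq p r (Ne.symm hr) hp (Ne.symm h0) h

lemma reach_basis_of_sympForm_eq_one {T : Finset (Fin g)} {p : Fin g ⊕ Fin g} (hp : idx p ∈ T)
    {v w : Fin g ⊕ Fin g → ℤ} (hT : ∀ r, idx r ∉ T → v r = 0) (hvw : sympForm v w = 1) :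
    Reach (outside T) v (Pi.single p 1) := by
  have hv : v ≠ 0 := by
    rintro rfl
    simp [sympForm] at hvw
  obtain ⟨q, c, hq, hr⟩ := exists_reach_single _ v rfl hT hv
  refine hr.trans (reach_single hp hq ?_)
  obtain ⟨h, -, hh⟩ := hr
  rw [← sympForm_mulVec h, hh, sympForm_single_left] at hvw
  exact Int.isUnit_iff.1 (IsUnit.of_mul_eq_one _ hvw)

lemma reach_add_single {P : Set (Fin g ⊕ Fin g)} {p : Fin g ⊕ Fin g} (hp : p.swap ∉ P)
    {v : Fin g ⊕ Fin g → ℤ} (hv : v p.swap = 1) (n : ℕ) :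
    Reach P v (v + Pi.single p (sgn p * n)) := by
  induction n with
  | zero => simpa using Reach.refl P v
  | succ n ih =>
    refine ih.trans ?_
    convert reach_transvection hp (v + Pi.single p (sgn p * n)) using 1
    simp [swap_ne, hv, add_assoc, ← Pi.single_add, mul_add]

/-- A vector `v` with `ω(αᵢ, v) = 1` is brought to `βᵢ` while fixing `αᵢ`. -/
lemma reach_beta {T : Finset (Fin g)} {i : Fin g} (hi : i ∈ T) (n : ℕ) :
    ∀ v : Fin g ⊕ Fin g → ℤ, ∑ r with idx r ≠ i, (v r).natAbs = n →
      (∀ r, idx r ∉ T → v r = 0) → v (Sum.inr i) = 1 →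
      Reach (insert (Sum.inl i) (outside T)) v (Pi.single (Sum.inr i) 1) := by
  have hβ : (Sum.inl i : Fin g ⊕ Fin g).swap ∉ insert (Sum.inl i) (outside T) := by
    simpa [outside, idx] using hi
  induction n using Nat.strong_induction_on with
  | _ n ih =>
    intro v hn hT hv
    have hmem : ∀ r, v r ≠ 0 → idx r ∈ T := fun r hr => by_contra fun h => hr (hT r h)
    by_cases hex : ∃ p, idx p ≠ i ∧ v p ≠ 0
    · obtain ⟨p, hpi, hp⟩ := hex
      have hp' : p.swap ∉ insert (Sum.inl i) (outside T) := by
        rintro (h | h)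
        · exact hpi (by rw [← idx_swap, h]; rfl)
        · exact h (by simpa using hmem p hp)
      have step : ∀ x, Reach (insert (Sum.inl i) (outside T)) x
          (x - Pi.single (Sum.inl i) (sgn p * x p.swap) - Pi.single p (x (Sum.inr i))) := by
        intro x
        have := reach_pair (p := p) (q := Sum.inl i) hpi hp' hβ x
        simpa [sgn] using this
      have hpl : Sum.inl i ≠ p := by rintro rfl; exact hpi rfl
      have hpr : Sum.inr i ≠ p := by rintro rfl; exact hpi rfl
      have hps : Sum.inl i ≠ p.swap := by rintro h; exact hpi (by rw [← idx_swap, ← h]; rfl)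
      have main : ∀ x : Fin g ⊕ Fin g → ℤ, Reach (insert (Sum.inl i) (outside T)) v x →
          (∀ r, r ≠ Sum.inl i → r ≠ p → x r = v r) → (x p).natAbs < (v p).natAbs →
          Reach (insert (Sum.inl i) (outside T)) v (Pi.single (Sum.inr i) 1) := by
        intro x hx hxv hlt
        refine hx.trans (ih _ ?_ x rfl ?_ ?_)
        · rw [← hn]
          refine Finset.sum_lt_sum (fun r hr => ?_) ⟨p, by simpa using hpi, hlt⟩
          by_cases hrp : r = p
          · subst hrp; exact hlt.le
          · rw [hxv r (by rintro rfl; exact (Finset.mem_filter.1 hr).2 rfl) hrp]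
        · intro r hr
          rw [hxv r (by rintro rfl; exact hr hi) (by rintro rfl; exact hr (hmem _ hp)), hT r hr]
        · rw [hxv _ (by simp) hpr, hv]
      rcases lt_or_gt_of_ne hp with hneg | hpos
      · refine main (v + Pi.single (Sum.inl i) (sgn p * v p.swap) + Pi.single p 1) ?_ ?_ ?_
        · have := step (v + Pi.single (Sum.inl i) (sgn p * v p.swap) + Pi.single p 1)
          refine Reach.symm ?_
          convert this using 1
          simp [hpr, hps.symm, swap_ne, hv]
          abel
        · intro r h₁ h₂
          simp [h₁, h₂]
        · simp [hpl.symm]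
          lia
      · refine main _ (step v) ?_ ?_
        · intro r h₁ h₂
          simp [h₁, h₂]
        · simp [hpl.symm, hv]
          lia
    · push Not at hex
      have hv' : v = Pi.single (Sum.inr i) 1 + Pi.single (Sum.inl i) (v (Sum.inl i)) := by
        ext r
        by_cases hr : idx r = i
        · rcases r with r | r <;> obtain rfl : r = i := hr
          · simp
          · simpa using hv
        · have h₁ : r ≠ Sum.inl i := by rintro rfl; exact hr rfl
          have h₂ : r ≠ Sum.inr i := by rintro rfl; exact hr rfl
          simp [h₁, h₂, hex r hr]
      rcases Int.eq_nat_or_neg (v (Sum.inl i)) with ⟨n, hn | hn⟩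
      · have := reach_add_single hβ (v := Pi.single (Sum.inr i) 1) (by simp) n
        rw [hv', hn]
        simpa [sgn] using this.symm
      · have := reach_add_single hβ (v := v) (by simpa using hv) n
        convert this using 1
        rw [hv', hn]
        simp [sgn, add_assoc, ← Pi.single_add]

lemma apply_eq_zero_of_fixes {A : Matrix.symplecticGroup (Fin g) ℤ} {r : Fin g ⊕ Fin g}
    (hA : A.val *ᵥ Pi.single r.swap 1 = Pi.single r.swap 1) {q : Fin g ⊕ Fin g} (hq : q ≠ r) :
    (A.val *ᵥ Pi.single q 1) r = 0 := by
  have h := sympForm_mulVec A (Pi.single r.swap 1) (Pi.single q 1)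
  rw [hA, sympForm_single_left, sympForm_single_left] at h
  rcases sgn_cases r.swap with hs | hs <;> simpa [hs, hq.symm] using h

lemma mem_elemSubgroup_of_fixes (T : Finset (Fin g)) :
    ∀ A : Matrix.symplecticGroup (Fin g) ℤ,
      (∀ p ∈ outside T, A.val *ᵥ Pi.single p 1 = Pi.single p 1) → A ∈ elemSubgroup g := by
  induction T using Finset.induction_on with
  | empty =>
    intro A hA
    have : A = 1 := by
      ext p q
      have := congrFun (hA q (by simp [outside])) p
      simpa [Matrix.one_apply, Pi.single_apply] using this
    exact this ▸ one_mem _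
  | insert i S hiS ih =>
    have hi : i ∈ insert i S := Finset.mem_insert_self i S
    have hsupp : ∀ A : Matrix.symplecticGroup (Fin g) ℤ,
        (∀ p ∈ outside (insert i S), A.val *ᵥ Pi.single p 1 = Pi.single p 1) →
        ∀ q, idx q = i → ∀ r, idx r ∉ insert i S → (A.val *ᵥ Pi.single q 1) r = 0 := by
      intro A hA q hq r hr
      refine apply_eq_zero_of_fixes (hA _ (by simpa [outside] using hr)) ?_
      rintro rfl
      exact hr (hq ▸ hi)
    intro A hA
    obtain ⟨h, hh, hα⟩ := reach_basis_of_sympForm_eq_one (p := Sum.inl i) hi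
      (hsupp A hA (Sum.inl i) rfl) (w := A.val *ᵥ Pi.single (Sum.inr i) 1) (by
        rw [sympForm_mulVec, sympForm_single_left]
        simp [sgn])
    have hB : ∀ p ∈ outside (insert i S), (h * A).val *ᵥ Pi.single p 1 = Pi.single p 1 := by
      intro p hp
      rw [Submonoid.coe_mul, ← Matrix.mulVec_mulVec, hA p hp, hh.2 p hp]
    have hBα : (h * A).val *ᵥ Pi.single (Sum.inl i) 1 = Pi.single (Sum.inl i) 1 := by
      rw [Submonoid.coe_mul, ← Matrix.mulVec_mulVec, hα]
    obtain ⟨k, hk, hβ⟩ := reach_beta hi _ _ rfl (hsupp _ hB (Sum.inr i) rfl) (by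
      have := sympForm_mulVec (h * A) (Pi.single (Sum.inl i) 1) (Pi.single (Sum.inr i) 1)
      rw [hBα, sympForm_single_left, sympForm_single_left] at this
      simpa [sgn] using this)
    have hC : k * (h * A) ∈ elemSubgroup g := by
      refine ih _ fun p hp => ?_
      rw [Submonoid.coe_mul, ← Matrix.mulVec_mulVec]
      by_cases hpi : idx p = i
      · rcases p with j | j <;> obtain rfl : j = i := hpi
        · rw [hBα, hk.2 _ (Set.mem_insert _ _)]
        · exact hβ
      · have hp' : p ∈ outside (insert i S) := by
          simpa [outside, hpi] using hp
        rw [hB p hp', hk.2 p (Set.mem_insert_of_mem _ hp')]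
    exact (Subgroup.mul_mem_cancel_left _ hh.1).1 ((Subgroup.mul_mem_cancel_left _ hk.1).1 hC)

end SympGen

/-- **Lemma 9.2**. The transvections `t_{αᵢ}, t_{βᵢ}` (`i = 1, …, g`) together with the
elements `μ_{ij} = t_{αᵢ} t_{αⱼ} t_{αᵢ+αⱼ}⁻¹`, `η_{ij} = t_{βᵢ} t_{βⱼ} t_{βᵢ+βⱼ}⁻¹` and
`ν_{ij} = t_{αᵢ} t_{βⱼ} t_{αᵢ+βⱼ}⁻¹` (`i ≠ j`) generate the symplectic group
`Sp_{2g}(ℤ)`. -/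
theorem symplectic_generated_by_transvections_mu_eta_nu (g : ℕ) :
    Subgroup.closure {x : Matrix.symplecticGroup (Fin g) ℤ |
      (∃ i, x.val = transvection (alphaV g i) ∨ x.val = transvection (betaV g i)) ∨
      (∃ i j, i ≠ j ∧
        (x.val = muT g i j ∨ x.val = etaT g i j ∨ x.val = nuT g i j))} = ⊤ := by
  refine (Subgroup.eq_top_iff' _).2 fun A => ?_
  exact SympGen.mem_elemSubgroup_of_fixes Finset.univ A fun p hp =>
    absurd (Finset.mem_univ _) hp
end
end

section
/- Let ω be the standard symplectic form on ℤ^{2g} with basis α₁, …, α_g, β₁, …, β_g. Let St(α₁) = {h ∈ Sp_{2g}(ℤ) : h(α₁) = α₁} be the stabilizer of α₁ and T(α₁) the subgroup of Sp_{2g}(ℤ) generated by all transvections t_γ with ω(γ, α₁) = 0. Then T(α₁) = St(α₁); moreover, this group is generated by the elements t_{α_i} (i = 1, …, g), t_{β_i} (i = 2, …, g), μ_{ij} (i ≠ j), η_{ij} (i ≠ j, i, j ≥ 2), and ν_{ij} (i ≠ j, j ≠ 1), where μ_{ij} = t_{α_i} t_{α_j} t_{α_i + α_j}⁻¹, η_{ij}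 = t_{β_i} t_{β_j} t_{β_i + β_j}⁻¹, ν_{ij} = t_{α_i} t_{β_j} t_{α_i + β_j}⁻¹. -/
/-! Common definitions: the standard symplectic form `ω` on `ℤ^{2g}` with basis
`α₁, …, α_g, β₁, …, β_g` (indexed by `Fin g ⊕ Fin g`), transvections, and the
elements `μ_{ij}`, `η_{ij}`, `ν_{ij}`. -/

open Matrix

noncomputable section

/-- The stabilizer of the vector `v ∈ ℤ^{2g}` in the symplectic group `Sp_{2g}(ℤ)`. -/
def stabSubgroup (g : ℕ) (v : Fin g ⊕ Fin g → ℤ) :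
    Subgroup (Matrix.symplecticGroup (Fin g) ℤ) where
  carrier := {x | x.val *ᵥ v = v}
  one_mem' := by
    show ((1 : Matrix.symplecticGroup (Fin g) ℤ) : Matrix _ _ ℤ) *ᵥ v = v
    simp
  mul_mem' := by
    intro a b ha hb
    show ((a * b : Matrix.symplecticGroup (Fin g) ℤ) : Matrix _ _ ℤ) *ᵥ v = v
    rw [Submonoid.coe_mul, ← Matrix.mulVec_mulVec, hb, ha]
  inv_mem' := by
    intro x hx
    show ((x⁻¹ : Matrix.symplecticGroup (Fin g) ℤ) : Matrix _ _ ℤ) *ᵥ v = v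
    have h1 : ((x⁻¹ * x : Matrix.symplecticGroup (Fin g) ℤ) : Matrix _ _ ℤ) *ᵥ v = v := by
      rw [inv_mul_cancel]
      show ((1 : Matrix.symplecticGroup (Fin g) ℤ) : Matrix _ _ ℤ) *ᵥ v = v
      simp
    rw [Submonoid.coe_mul, ← Matrix.mulVec_mulVec, hx] at h1
    exact h1
namespace SympTransvection

open Sum

variable {g : ℕ}

/-- The index `i` of the basis vector `αᵢ` or `βᵢ`. -/
def idx (p : Fin g ⊕ Fin g) : Fin g := Sum.elim id id p

/-- The sign `ω(αᵢ, βᵢ) = 1`, respectively `ω(βᵢ, αᵢ) = -1`. -/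
def sgn (p : Fin g ⊕ Fin g) : ℤ := Sum.elim (fun _ => 1) (fun _ => -1) p

@[simp] lemma idx_swap (p : Fin g ⊕ Fin g) : idx p.swap = idx p := by
  cases p <;> rfl

@[simp] lemma sgn_mul_self (p : Fin g ⊕ Fin g) : sgn p * sgn p = 1 := by
  cases p <;> simp [sgn]

lemma swap_ne_self (p : Fin g ⊕ Fin g) : p.swap ≠ p := by
  cases p <;> simp

lemma sympForm_eq (x y : Fin g ⊕ Fin g → ℤ) :
    sympForm x y = ∑ i, (x (inl i) * y (inr i) - x (inr i) * y (inl i)) := by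
  rw [Finset.sum_sub_distrib, sub_eq_add_neg]
  simp [sympForm, sympJ, dotProduct, mulVec, Fintype.sum_sum_type, Matrix.one_apply]

lemma sympForm_add_left (x y z : Fin g ⊕ Fin g → ℤ) :
    sympForm (x + y) z = sympForm x z + sympForm y z := by
  simp [sympForm, add_dotProduct]

lemma sympForm_add_right (x y z : Fin g ⊕ Fin g → ℤ) :
    sympForm x (y + z) = sympForm x y + sympForm x z := by
  simp [sympForm, mulVec_add, dotProduct_add]

lemma sympForm_sub_right (x y z : Fin g ⊕ Fin g → ℤ) :
    sympForm x (y - z) = sympForm x y - sympForm x z := by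
  simp [sympForm, mulVec_sub, dotProduct_sub]

lemma sympForm_smul_right (x y : Fin g ⊕ Fin g → ℤ) (c : ℤ) :
    sympForm x (c • y) = c * sympForm x y := by
  simp only [sympForm, mulVec_smul, dotProduct_smul, smul_eq_mul]

lemma sympForm_smul_left (x y : Fin g ⊕ Fin g → ℤ) (c : ℤ) :
    sympForm (c • x) y = c * sympForm x y := by
  simp only [sympForm, smul_dotProduct, smul_eq_mul]

lemma sympForm_swap (x y : Fin g ⊕ Fin g → ℤ) : sympForm x y = -sympForm y x := by
  rw [sympForm_eq, sympForm_eq, ← Finset.sum_neg_distrib]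
  exact Finset.sum_congr rfl fun i _ => by ring

@[simp] lemma sympForm_self (x : Fin g ⊕ Fin g → ℤ) : sympForm x x = 0 := by
  have := sympForm_swap x x
  omega

lemma sympForm_single (p : Fin g ⊕ Fin g) (x : Fin g ⊕ Fin g → ℤ) :
    sympForm (Pi.single p 1) x = sgn p * x p.swap := by
  rw [sympForm, single_dotProduct]
  cases p <;> simp [sympJ, sgn, mulVec, dotProduct, Fintype.sum_sum_type, Matrix.one_apply]

lemma transvection_mulVec (γ x : Fin g ⊕ Fin g → ℤ) :
    transvection γ *ᵥ x = x + sympForm γ x • γ := by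
  rw [_root_.transvection, add_mulVec, one_mulVec, vecMulVec_mulVec, sympForm, dotProduct_mulVec]
  simp

lemma transvectionInv_mulVec (γ x : Fin g ⊕ Fin g → ℤ) :
    transvectionInv γ *ᵥ x = x - sympForm γ x • γ := by
  rw [transvectionInv, sub_mulVec, one_mulVec, vecMulVec_mulVec, sympForm, dotProduct_mulVec]
  simp

lemma J_eq_neg_sympJ : Matrix.J (Fin g) ℤ = -sympJ g := by
  simp [Matrix.J, sympJ, fromBlocks_neg]

lemma mem_symplectic_iff (A : Matrix (Fin g ⊕ Fin g) (Fin g ⊕ Fin g) ℤ) :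
    A ∈ symplecticGroup (Fin g) ℤ ↔
      ∀ x y, sympForm (A *ᵥ x) (A *ᵥ y) = sympForm x y := by
  rw [SymplecticGroup.mem_iff', J_eq_neg_sympJ]
  have key : ∀ x y, sympForm (A *ᵥ x) (A *ᵥ y) = x ⬝ᵥ ((Aᵀ * sympJ g * A) *ᵥ y) := by
    intro x y
    rw [sympForm, ← mulVec_mulVec, ← mulVec_mulVec, dotProduct_mulVec x Aᵀ, vecMul_transpose]
  simp only [key, Matrix.mul_neg, Matrix.neg_mul, neg_inj]
  refine ⟨fun h x y => by rw [h, sympForm], fun h => ?_⟩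
  ext i j
  have := h (Pi.single i 1) (Pi.single j 1)
  rw [sympForm, single_one_dotProduct, single_one_dotProduct, mulVec_single_one,
    mulVec_single_one] at this
  exact this

lemma sympForm_coe_mulVec (h : symplecticGroup (Fin g) ℤ) (x y : Fin g ⊕ Fin g → ℤ) :
    sympForm (h.val *ᵥ x) (h.val *ᵥ y) = sympForm x y :=
  (mem_symplectic_iff _).1 h.2 x y

lemma mul_mulVec (a b : symplecticGroup (Fin g) ℤ) (x : Fin g ⊕ Fin g → ℤ) :
    (a * b).val *ᵥ x = a.val *ᵥ (b.val *ᵥ x) := by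
  rw [mulVec_mulVec]; rfl

lemma one_mulVec' (x : Fin g ⊕ Fin g → ℤ) :
    (1 : symplecticGroup (Fin g) ℤ).val *ᵥ x = x := one_mulVec x

lemma inv_mulVec_eq_iff (a : symplecticGroup (Fin g) ℤ) (x y : Fin g ⊕ Fin g → ℤ) :
    a⁻¹.val *ᵥ x = y ↔ x = a.val *ᵥ y := by
  constructor
  · rintro rfl
    rw [← mul_mulVec, mul_inv_cancel, one_mulVec']
  · rintro rfl
    rw [← mul_mulVec, inv_mul_cancel, one_mulVec']

lemma ext_mulVec {A B : Matrix (Fin g ⊕ Fin g) (Fin g ⊕ Fin g) ℤ}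
    (h : ∀ x, A *ᵥ x = B *ᵥ x) : A = B := by
  ext i j
  simpa using congrFun (h (Pi.single j 1)) i

lemma ext_single {A B : symplecticGroup (Fin g) ℤ}
    (h : ∀ p, A.val *ᵥ Pi.single p 1 = B.val *ᵥ Pi.single p 1) : A = B := by
  apply Subtype.ext
  ext i j
  simpa using congrFun (h j) i

/-- The transvection `t_γ` as an element of the symplectic group. -/
def tSp (γ : Fin g ⊕ Fin g → ℤ) : symplecticGroup (Fin g) ℤ :=
  ⟨transvection γ, (mem_symplectic_iff _).2 fun x y => by
    simp only [transvection_mulVec, sympForm_add_right, sympForm_add_left, sympForm_smul_left,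
      sympForm_smul_right, sympForm_self]
    rw [sympForm_swap x γ]
    ring⟩

lemma tSp_mulVec (γ x : Fin g ⊕ Fin g → ℤ) :
    (tSp γ).val *ᵥ x = x + sympForm γ x • γ := transvection_mulVec γ x

lemma tSp_inv_mulVec (γ x : Fin g ⊕ Fin g → ℤ) :
    (tSp γ)⁻¹.val *ᵥ x = x - sympForm γ x • γ := by
  rw [inv_mulVec_eq_iff, tSp_mulVec]
  simp [sympForm_sub_right, sympForm_smul_right, -zsmul_eq_mul]

lemma tSp_inv_val (γ : Fin g ⊕ Fin g → ℤ) : (tSp γ)⁻¹.val = transvectionInv γ :=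
  ext_mulVec fun x => by rw [tSp_inv_mulVec, transvectionInv_mulVec]

/-- The product `t_u t_w t_{u+w}⁻¹` in the symplectic group. -/
def nSp (u w : Fin g ⊕ Fin g → ℤ) : symplecticGroup (Fin g) ℤ :=
  tSp u * tSp w * (tSp (u + w))⁻¹

lemma nSp_val (u w : Fin g ⊕ Fin g → ℤ) :
    (nSp u w).val = transvection u * transvection w * transvectionInv (u + w) := by
  rw [← tSp_inv_val]; rfl

lemma nSp_mulVec {u w : Fin g ⊕ Fin g → ℤ} (huw : sympForm u w = 0) (x : Fin g ⊕ Fin g → ℤ) :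
    (nSp u w).val *ᵥ x = x + -(sympForm u x • w + sympForm w x • u) := by
  have hwu : sympForm w u = 0 := by rw [sympForm_swap, huw, neg_zero]
  rw [nSp, mul_mulVec, mul_mulVec, tSp_inv_mulVec, tSp_mulVec, tSp_mulVec]
  simp only [sympForm_add_right, sympForm_sub_right, sympForm_add_left, sympForm_smul_right,
    sympForm_self, huw, hwu]
  ext i
  simp
  ring

lemma nSp_comm {u w : Fin g ⊕ Fin g → ℤ} (huw : sympForm u w = 0) : nSp u w = nSp w u := by
  have hwu : sympForm w u = 0 := by rw [sympForm_swap, huw, neg_zero]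
  exact ext_single fun p => by rw [nSp_mulVec huw, nSp_mulVec hwu, add_comm (_ • w)]

lemma zpow_mulVec (e : symplecticGroup (Fin g) ℤ)
    (φ : (Fin g ⊕ Fin g → ℤ) → (Fin g ⊕ Fin g → ℤ))
    (he : ∀ x, e.val *ᵥ x = x + φ x) (hφ : ∀ x, φ (x + φ x) = φ x) (c : ℤ) :
    ∀ x, (e ^ c).val *ᵥ x = x + c • φ x := by
  induction c using Int.induction_on with
  | zero => intro x; rw [zpow_zero, one_mulVec']; simp
  | succ n ih =>
    intro x
    rw [_root_.zpow_add_one, mul_mulVec, ih, he, hφ]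
    module
  | pred n ih =>
    intro x
    obtain ⟨y, rfl⟩ : ∃ y, x = e.val *ᵥ y := ⟨_, ((inv_mulVec_eq_iff e x _).1 rfl)⟩
    rw [← mul_mulVec, ← _root_.zpow_add_one, sub_add_cancel, ih, he, hφ]
    module

lemma exists_add_partner {H : Subgroup (symplecticGroup (Fin g) ℤ)} {p : Fin g ⊕ Fin g}
    (hH : tSp (Pi.single p 1) ∈ H) (c : ℤ) (v : Fin g ⊕ Fin g → ℤ) :
    ∃ e ∈ H, e.val *ᵥ v = v + Pi.single p (c * v p.swap) := by
  refine ⟨_, H.zpow_mem hH (c * sgn p), ?_⟩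
  rw [zpow_mulVec _ _ (tSp_mulVec _)]
  · rw [sympForm_single, smul_smul, ← Pi.single_smul]
    congr 2
    simp only [smul_eq_mul, mul_one]
    linear_combination c * v p.swap * sgn_mul_self p
  · intro x
    simp [sympForm_add_right, sympForm_smul_right, -zsmul_eq_mul]

lemma sympForm_single_single {p q : Fin g ⊕ Fin g} (hpq : q ≠ p.swap) :
    sympForm (Pi.single p 1) (Pi.single q 1) = 0 := by
  rw [sympForm_single, Pi.single_eq_of_ne hpq.symm, mul_zero]

lemma exists_add_entry {H : Subgroup (symplecticGroup (Fin g) ℤ)} {p q : Fin g ⊕ Fin g}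
    (hpq : p ≠ q) (hH : nSp (Pi.single p 1) (Pi.single q.swap 1) ∈ H) (c : ℤ)
    (v : Fin g ⊕ Fin g → ℤ) :
    ∃ e ∈ H, ∃ d : ℤ, (v p.swap = 0 → d = 0) ∧
      e.val *ᵥ v = v + Pi.single p (c * v q) + Pi.single q.swap d := by
  have h0 : sympForm (Pi.single p (1 : ℤ)) (Pi.single q.swap 1) = 0 :=
    sympForm_single_single fun h => hpq (by simpa using congrArg Sum.swap h.symm)
  have h1 : sympForm (Pi.single q.swap (1 : ℤ)) (Pi.single p 1) = 0 := by
    rw [sympForm_swap, h0, neg_zero]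
  refine ⟨_, H.zpow_mem hH (-(c * sgn q.swap)), c * sgn q.swap * (sgn p * v p.swap),
    fun h => by rw [h]; ring, ?_⟩
  rw [zpow_mulVec _ _ (nSp_mulVec h0)]
  · rw [sympForm_single, sympForm_single, Sum.swap_swap]
    ext i
    have := sgn_mul_self q.swap
    simp only [Pi.add_apply, Pi.smul_apply, Pi.neg_apply, Pi.single_apply, smul_eq_mul]
    split_ifs <;> first | ring1 | linear_combination c * v q * this
  · intro x
    simp [sympForm_add_right, sympForm_smul_right, ← sub_eq_add_neg, sympForm_sub_right, h0, h1,
      -zsmul_eq_mul, -neg_add_rev]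

/-- The elements of the symplectic group fixing the basis vectors with label in `R`. -/
def fixSub (R : Set (Fin g ⊕ Fin g)) : Subgroup (symplecticGroup (Fin g) ℤ) :=
  ⨅ r ∈ R, stabSubgroup g (Pi.single r 1)

lemma mem_fixSub {R : Set (Fin g ⊕ Fin g)} {h : symplecticGroup (Fin g) ℤ} :
    h ∈ fixSub R ↔ ∀ r ∈ R, h.val *ᵥ Pi.single r 1 = Pi.single r 1 := by
  simp only [fixSub, Subgroup.mem_iInf]; rfl

lemma tSp_mem_fixSub {R : Set (Fin g ⊕ Fin g)} {p : Fin g ⊕ Fin g} (hp : p.swap ∉ R) :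
    tSp (Pi.single p 1) ∈ fixSub R := by
  rw [mem_fixSub]
  intro r hr
  rw [tSp_mulVec, sympForm_single_single (by rintro rfl; exact hp hr)]
  simp

lemma nSp_mem_fixSub {R : Set (Fin g ⊕ Fin g)} {p q : Fin g ⊕ Fin g} (hp : p.swap ∉ R)
    (hq : q.swap ∉ R) (hpq : q ≠ p.swap) :
    nSp (Pi.single p 1) (Pi.single q 1) ∈ fixSub R := by
  rw [mem_fixSub]
  intro r hr
  rw [nSp_mulVec (sympForm_single_single hpq),
    sympForm_single_single (by rintro rfl; exact hp hr),
    sympForm_single_single (by rintro rfl; exact hq hr)]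
  simp

/-- An element of the symplectic group fixing `e_r` preserves the coordinate at `r.swap`. -/
lemma mulVec_apply_swap {h : symplecticGroup (Fin g) ℤ} {r : Fin g ⊕ Fin g}
    (hr : h.val *ᵥ Pi.single r 1 = Pi.single r 1) (x : Fin g ⊕ Fin g → ℤ) :
    (h.val *ᵥ x) r.swap = x r.swap := by
  have := sympForm_coe_mulVec h (Pi.single r 1) x
  rw [hr, sympForm_single, sympForm_single] at this
  have h1 := congrArg (sgn r * ·) this
  simpa only [← mul_assoc, sgn_mul_self, one_mul] using h1

lemma exists_clear {H : Subgroup (symplecticGroup (Fin g) ℤ)} {k : Fin g}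
    (ht : tSp (Pi.single (inl k) 1) ∈ H) (Q : Finset (Fin g ⊕ Fin g)) :
    (∀ p ∈ Q, idx p ≠ k ∧ nSp (Pi.single p 1) (Pi.single (inl k) 1) ∈ H) →
    ∀ v : Fin g ⊕ Fin g → ℤ, v (inr k) = 1 →
      (∀ r, r ∉ Q → idx r ≠ k → v r = 0) →
      ∃ e ∈ H, e.val *ᵥ v = Pi.single (inr k) 1 := by
  induction Q using Finset.induction_on with
  | empty =>
    intro _ v hv h0
    obtain ⟨e, he, hev⟩ := exists_add_partner ht (-v (inl k)) v
    refine ⟨e, he, hev.trans ?_⟩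
    ext r
    by_cases hr : idx r = k
    · rcases r with r | r <;> obtain rfl : r = k := hr <;> simp [hv]
    · rw [Pi.add_apply, h0 r (by simp) hr, Pi.single_eq_of_ne, Pi.single_eq_of_ne]
      · simp
      all_goals (rintro rfl; exact hr rfl)
  | insert p Q hp ih =>
    intro hQ v hv h0
    obtain ⟨hpk, hn⟩ := hQ p (by simp)
    have h1 : p ≠ inr k := by rintro rfl; exact hpk rfl
    have h2 : p ≠ inl k := by rintro rfl; exact hpk rfl
    obtain ⟨e, he, d, -, hev⟩ := exists_add_entry (q := inr k) h1 hn (-v p) v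
    obtain ⟨f, hf, hfv⟩ := ih (fun q hq => hQ q (by simp [hq])) (e.val *ᵥ v)
      (by rw [hev]; simp [hv, h1.symm])
      (by
        intro r hr hrk
        have h3 : r ≠ inl k := by rintro rfl; exact hrk rfl
        rw [hev]
        by_cases hrp : r = p
        · subst hrp
          simp [hv, h3]
        · simp [hrp, h3, h0 r (by simp [hr, hrp]) hrk])
    exact ⟨f * e, H.mul_mem hf he, by rw [mul_mulVec, hfv]⟩

lemma exists_natAbs_add_lt {a b : ℤ} (hb : b ≠ 0) (hab : b.natAbs ≤ a.natAbs) :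
    ∃ c : ℤ, (a + c * b).natAbs < a.natAbs := by
  rcases lt_or_ge 0 a with ha | ha <;> rcases lt_or_gt_of_ne hb with hneg | hpos
  · exact ⟨1, by omega⟩
  · exact ⟨-1, by omega⟩
  · exact ⟨-1, by omega⟩
  · exact ⟨1, by omega⟩

section Reduction

variable {H : Subgroup (symplecticGroup (Fin g) ℤ)} {S : Finset (Fin g)}

lemma exists_row_op (ht : ∀ p, idx p ∈ S → tSp (Pi.single p 1) ∈ H)
    (hn : ∀ p q, idx p ∈ S → idx q ∈ S → p ≠ q → q ≠ p.swap →
      nSp (Pi.single p 1) (Pi.single q 1) ∈ H)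
    {p q : Fin g ⊕ Fin g} (hp : idx p ∈ S) (hq : idx q ∈ S) (hpq : p ≠ q)
    (c : ℤ) (v : Fin g ⊕ Fin g → ℤ) (hv : q = p.swap ∨ v p.swap = 0) :
    ∃ e ∈ H, e.val *ᵥ v = v + Pi.single p (c * v q) := by
  by_cases hqp : q = p.swap
  · subst hqp
    exact exists_add_partner (ht p hp) c v
  · obtain ⟨e, he, d, hd, hev⟩ := exists_add_entry hpq
      (hn p q.swap hp (by simpa using hq) (fun h => hqp (by rw [h, Sum.swap_swap]))
        (fun h => hpq (by simpa using congrArg Sum.swap h.symm))) c v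
    refine ⟨e, he, ?_⟩
    rw [hev, hd (hv.resolve_left hqp)]
    simp

lemma exists_mulVec_eq_single (ht : ∀ p, idx p ∈ S → tSp (Pi.single p 1) ∈ H)
    (hn : ∀ p q, idx p ∈ S → idx q ∈ S → p ≠ q → q ≠ p.swap →
      nSp (Pi.single p 1) (Pi.single q 1) ∈ H) {k : Fin g} (hk : k ∈ S) (n : ℕ) :
    ∀ v : Fin g ⊕ Fin g → ℤ, (∀ p, idx p ∉ S → v p = 0) → ∑ p, (v p).natAbs = n →
      ∃ e ∈ H, ∃ c : ℤ, e.val *ᵥ v = Pi.single (inl k) c := by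
  induction n using Nat.strong_induction_on with
  | _ n ih =>
  intro v hv hsum
  have hS : ∀ p, v p ≠ 0 → idx p ∈ S := fun p hp => by
    by_contra h
    exact hp (hv p h)
  have step : ∀ p q, p ≠ q → v p ≠ 0 → v q ≠ 0 → (q = p.swap ∨ v p.swap = 0) →
      (v q).natAbs ≤ (v p).natAbs → ∃ e ∈ H, ∃ c : ℤ, e.val *ᵥ v = Pi.single (inl k) c := by
    intro p q hpq hp hq hcond hle
    obtain ⟨c, hc⟩ := exists_natAbs_add_lt hq hle
    obtain ⟨e, he, hev⟩ := exists_row_op ht hn (hS p hp) (hS q hq) hpq c v hcond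
    obtain ⟨f, hf, d, hfd⟩ := ih _ (hsum ▸ Finset.sum_lt_sum (s := Finset.univ)
      (f := fun r => ((e.val *ᵥ v) r).natAbs) (g := fun r => (v r).natAbs)
      (by
        intro r _
        rw [hev]
        by_cases hr : r = p
        · subst hr
          simpa using hc.le
        · simp [hr])
      ⟨p, Finset.mem_univ _, by rw [hev]; simpa using hc⟩) (e.val *ᵥ v)
      (by
        intro r hr
        have hrp : r ≠ p := by rintro rfl; exact hr (hS _ hp)
        rw [hev]
        simp [hrp, hv r hr]) rfl
    exact ⟨f * e, H.mul_mem hf he, d, by rw [mul_mulVec, hfd]⟩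
  have step' : ∀ p q, p ≠ q → v p ≠ 0 → v q ≠ 0 →
      (q = p.swap ∨ (v p.swap = 0 ∧ v q.swap = 0)) →
      ∃ e ∈ H, ∃ c : ℤ, e.val *ᵥ v = Pi.single (inl k) c := by
    intro p q hpq hp hq hcond
    rcases le_total (v q).natAbs (v p).natAbs with hle | hle
    · exact step p q hpq hp hq (hcond.imp_right And.left) hle
    · exact step q p hpq.symm hq hp
        (hcond.imp (fun h => by rw [h, Sum.swap_swap]) And.right) hle
  by_cases h1 : ∃ p, v p ≠ 0 ∧ v p.swap ≠ 0
  · obtain ⟨p, hp, hp'⟩ := h1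
    exact step' p p.swap (swap_ne_self p).symm hp hp' (Or.inl rfl)
  push Not at h1
  by_cases h2 : ∃ p q, p ≠ q ∧ v p ≠ 0 ∧ v q ≠ 0
  · obtain ⟨p, q, hpq, hp, hq⟩ := h2
    exact step' p q hpq hp hq (Or.inr ⟨h1 p hp, h1 q hq⟩)
  push Not at h2
  by_cases h3 : ∃ p, p ≠ inl k ∧ v p ≠ 0
  · obtain ⟨p, hpk, hp⟩ := h3
    have hvp : v = Pi.single p (v p) := by
      ext r
      by_cases hr : r = p
      · subst hr; simp
      · rw [Pi.single_eq_of_ne hr]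
        exact h2 p r (Ne.symm hr) hp
    generalize hc : v p = c at hvp hp
    have hkS : idx (inl k : Fin g ⊕ Fin g) ∈ S := hk
    have hpS : idx p ∈ S := hS p (hc ▸ hp)
    obtain ⟨e, he, hev⟩ := exists_row_op ht hn hkS hpS hpk.symm 1 v (by
      rw [hvp]
      by_cases h : p = (inl k : Fin g ⊕ Fin g).swap
      · exact Or.inl h
      · exact Or.inr (Pi.single_eq_of_ne (Ne.symm h) _))
    obtain ⟨f, hf, hfv⟩ := exists_row_op ht hn hpS hkS hpk (-1) (e.val *ᵥ v) (by
      rw [hev, hvp]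
      by_cases h : inl k = p.swap
      · exact Or.inl h
      · exact Or.inr (by simp [swap_ne_self, Ne.symm h]))
    refine ⟨f * e, H.mul_mem hf he, c, ?_⟩
    rw [mul_mulVec, hfv, hev, hvp]
    ext r
    by_cases h4 : r = p
    · subst h4; simp [hpk, hpk.symm]
    · simp [h4, hpk.symm]
  · push Not at h3
    refine ⟨1, H.one_mem, v (inl k), ?_⟩
    rw [one_mulVec']
    ext r
    by_cases hr : r = inl k
    · subst hr; simp
    · rw [Pi.single_eq_of_ne hr, h3 r hr]

lemma exists_mulVec_eq_alpha (ht : ∀ p, idx p ∈ S → tSp (Pi.single p 1) ∈ H)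
    (hn : ∀ p q, idx p ∈ S → idx q ∈ S → p ≠ q → q ≠ p.swap →
      nSp (Pi.single p 1) (Pi.single q 1) ∈ H) {k : Fin g} (hk : k ∈ S)
    (v w : Fin g ⊕ Fin g → ℤ) (hv : ∀ p, idx p ∉ S → v p = 0) (hvw : sympForm v w = 1) :
    ∃ e ∈ H, e.val *ᵥ v = Pi.single (inl k) 1 := by
  obtain ⟨e, he, c, hev⟩ := exists_mulVec_eq_single ht hn hk _ v hv rfl
  have hc : c * sympForm (Pi.single (inl k) 1) (e.val *ᵥ w) = 1 := by
    rw [← sympForm_smul_left, ← Pi.single_smul, smul_eq_mul, mul_one, ← hev, sympForm_coe_mulVec,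
      hvw]
  rcases Int.eq_one_or_neg_one_of_mul_eq_one hc with rfl | rfl
  · exact ⟨e, he, hev⟩
  have hl : tSp (Pi.single (inl k) 1) ∈ H := ht _ hk
  have hr : tSp (Pi.single (inr k) 1) ∈ H := ht _ hk
  obtain ⟨a, ha, hav⟩ := exists_add_partner hr (-1) (e.val *ᵥ v)
  obtain ⟨b, hb, hbv⟩ := exists_add_partner hl 2 (a.val *ᵥ (e.val *ᵥ v))
  obtain ⟨d, hd, hdv⟩ := exists_add_partner hr (-1) (b.val *ᵥ (a.val *ᵥ (e.val *ᵥ v)))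
  refine ⟨d * (b * (a * e)), H.mul_mem hd (H.mul_mem hb (H.mul_mem ha he)), ?_⟩
  rw [mul_mulVec, mul_mulVec, mul_mulVec, hdv, hbv, hav, hev]
  ext r
  rcases r with r | r <;> by_cases h : r = k <;> simp [h]

end Reduction

section Generation

variable {G : Subgroup (symplecticGroup (Fin g) ℤ)} {o : Fin g}

lemma mem_of_fix_alpha
    (ht : ∀ p, p ≠ inr o → tSp (Pi.single p 1) ∈ G)
    (hn : ∀ p q, p ≠ inr o → q ≠ inr o → p ≠ q → q ≠ p.swap →
      nSp (Pi.single p 1) (Pi.single q 1) ∈ G)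
    {S : Finset (Fin g)} {k : Fin g} (hk : k ∉ S) (hS : o ∉ S)
    (ih : ∀ h ∈ fixSub {p : Fin g ⊕ Fin g | idx p ∉ S}, h ∈ G)
    (h : symplecticGroup (Fin g) ℤ)
    (hh : h ∈ fixSub {p : Fin g ⊕ Fin g | idx p ∉ S ∧ p ≠ inr k}) : h ∈ G := by
  set R : Set (Fin g ⊕ Fin g) := {p | idx p ∉ S ∧ p ≠ inr k} with hR
  have hfix := mem_fixSub.1 hh
  have hne : ∀ p : Fin g ⊕ Fin g, idx p ∈ S → p ≠ inr o := by
    rintro p hp rfl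
    exact hS hp
  obtain ⟨e, ⟨heG, heR⟩, he⟩ := exists_clear (H := G ⊓ fixSub R) (k := k)
    ⟨ht _ (by simp), tSp_mem_fixSub (by simp [hR])⟩
    (Finset.univ.filter fun p => idx p ∈ S)
    (by
      intro p hp
      have hpS : idx p ∈ S := by simpa using hp
      have hpk : idx p ≠ k := by rintro rfl; exact hk hpS
      have hp1 : inl k ≠ p.swap := by
        intro h1
        exact hpk (by rw [← idx_swap, ← h1]; rfl)
      refine ⟨hpk, hn _ _ (hne p hpS) (by simp) (by rintro rfl; exact hpk rfl) hp1,
        nSp_mem_fixSub (by simp [hR, hpS]) (by simp [hR]) hp1⟩)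
    (h.val *ᵥ Pi.single (inr k) 1)
    (by
      have := mulVec_apply_swap (hfix (inl k) ⟨hk, by simp⟩) (Pi.single (inr k) 1)
      simpa using this)
    (by
      intro r hr hrk
      have hr' : r.swap ∈ R := by
        refine ⟨by simpa using hr, ?_⟩
        intro h1
        exact hrk (by rw [← idx_swap, h1]; rfl)
      have := mulVec_apply_swap (hfix _ hr') (Pi.single (inr k) 1)
      rw [Sum.swap_swap] at this
      rw [this, Pi.single_eq_of_ne]
      rintro rfl
      exact hrk rfl)
  have hmem : e * h ∈ G := ih _ (by
    rw [mem_fixSub]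
    intro r hr
    by_cases hrk : r = inr k
    · rw [mul_mulVec, hrk, he]
    · rw [mul_mulVec, hfix r ⟨hr, hrk⟩, mem_fixSub.1 heR r ⟨hr, hrk⟩])
  exact (G.mul_mem_cancel_left heG).1 hmem

lemma mem_of_fix_compl
    (ht : ∀ p, p ≠ inr o → tSp (Pi.single p 1) ∈ G)
    (hn : ∀ p q, p ≠ inr o → q ≠ inr o → p ≠ q → q ≠ p.swap →
      nSp (Pi.single p 1) (Pi.single q 1) ∈ G)
    (S : Finset (Fin g)) (hS : o ∉ S) :
    ∀ h ∈ fixSub {p : Fin g ⊕ Fin g | idx p ∉ S}, h ∈ G := by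
  induction S using Finset.induction_on with
  | empty =>
    intro h hh
    have : h = 1 := ext_single fun p => by
      rw [mem_fixSub.1 hh p (by simp), one_mulVec']
    rw [this]
    exact G.one_mem
  | insert k S hk ih =>
    intro h hh
    have hfix := mem_fixSub.1 hh
    have hoS : o ∉ S := fun h1 => hS (by simp [h1])
    have hne : ∀ p : Fin g ⊕ Fin g, idx p ∈ insert k S → p ≠ inr o := by
      rintro p hp rfl
      exact hS hp
    obtain ⟨e, ⟨heG, heR⟩, he⟩ := exists_mulVec_eq_alpha (S := insert k S)
      (H := G ⊓ fixSub {p : Fin g ⊕ Fin g | idx p ∉ insert k S}) (k := k)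
      (fun p hp => ⟨ht p (hne p hp), tSp_mem_fixSub fun h1 => h1 (by rwa [idx_swap])⟩)
      (fun p q hp hq hpq hqp => ⟨hn p q (hne p hp) (hne q hq) hpq hqp,
        nSp_mem_fixSub (fun h1 => h1 (by rwa [idx_swap]))
          (fun h1 => h1 (by rwa [idx_swap])) hqp⟩)
      (by simp) (h.val *ᵥ Pi.single (inl k) 1) (h.val *ᵥ Pi.single (inr k) 1)
      (by
        intro p hp
        have := mulVec_apply_swap (hfix p.swap (by simpa using hp)) (Pi.single (inl k) 1)
        rw [Sum.swap_swap] at this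
        rw [this, Pi.single_eq_of_ne]
        rintro rfl
        exact hp (by simp [idx]))
      (by rw [sympForm_coe_mulVec, sympForm_single]; simp [sgn])
    have hmem : e * h ∈ G := mem_of_fix_alpha ht hn hk hoS (ih hoS) _ (by
      rw [mem_fixSub]
      rintro r ⟨hr, hrk⟩
      by_cases h1 : r = inl k
      · rw [h1, mul_mulVec, he]
      · have hr' : idx r ∉ insert k S := by
          rw [Finset.mem_insert, not_or]
          refine ⟨?_, hr⟩
          rintro rfl
          rcases r with r | r
          · exact h1 rfl
          · exact hrk rfl
        rw [mul_mulVec, hfix r hr', mem_fixSub.1 heR r hr'])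
    exact (G.mul_mem_cancel_left heG).1 hmem

lemma stabSubgroup_alphaV_le
    (ht : ∀ p, p ≠ inr o → tSp (Pi.single p 1) ∈ G)
    (hn : ∀ p q, p ≠ inr o → q ≠ inr o → p ≠ q → q ≠ p.swap →
      nSp (Pi.single p 1) (Pi.single q 1) ∈ G) :
    stabSubgroup g (alphaV g o) ≤ G := by
  intro h hh
  refine mem_of_fix_alpha ht hn (S := Finset.univ.erase o) (k := o) (by simp) (by simp)
    (mem_of_fix_compl ht hn _ (by simp)) h ?_
  rw [mem_fixSub]
  rintro r ⟨hr, hro⟩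
  have h1 : idx r = o := by simpa using hr
  rcases r with r | r
  · obtain rfl : r = o := h1
    exact hh
  · exact absurd (congrArg inr h1) hro

end Generation

end SympTransvection

/-- **Proposition 9.3**. The subgroup `T(α₁)` of `Sp_{2g}(ℤ)` generated by the
transvections `t_γ` with `ω(γ, α₁) = 0` coincides with the stabilizer `St(α₁)` of `α₁`;
moreover this group is generated by the elements `t_{αᵢ}` (`i = 1, …, g`), `t_{βᵢ}`
(`i ≠ 1`), `μ_{ij}` (`i ≠ j`), `η_{ij}` (`i ≠ j`, `i, j ≠ 1`) and `ν_{ij}`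
(`i ≠ j`, `j ≠ 1`). -/
theorem transvection_subgroup_eq_stabilizer (g : ℕ) (hg : 0 < g) :
    Subgroup.closure {x : Matrix.symplecticGroup (Fin g) ℤ |
        ∃ γ, sympForm γ (alphaV g ⟨0, hg⟩) = 0 ∧ x.val = transvection γ} =
      stabSubgroup g (alphaV g ⟨0, hg⟩) ∧
    stabSubgroup g (alphaV g ⟨0, hg⟩) =
      Subgroup.closure {x : Matrix.symplecticGroup (Fin g) ℤ |
        (∃ i, x.val = transvection (alphaV g i)) ∨
        (∃ i, i ≠ ⟨0, hg⟩ ∧ x.val = transvection (betaV g i)) ∨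
        (∃ i j, i ≠ j ∧ x.val = muT g i j) ∨
        (∃ i j, i ≠ j ∧ i ≠ ⟨0, hg⟩ ∧ j ≠ ⟨0, hg⟩ ∧ x.val = etaT g i j) ∨
        (∃ i j, i ≠ j ∧ j ≠ ⟨0, hg⟩ ∧ x.val = nuT g i j)} := by
  open SympTransvection in
  set o : Fin g := ⟨0, hg⟩
  have form_single (p : Fin g ⊕ Fin g) (hp : p ≠ Sum.inr o) :
      sympForm (Pi.single p 1) (alphaV g o) = 0 :=
    sympForm_single_single fun h => hp (by simpa using congrArg Sum.swap h.symm)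
  have transv_le : Subgroup.closure {x : Matrix.symplecticGroup (Fin g) ℤ |
      ∃ γ, sympForm γ (alphaV g o) = 0 ∧ x.val = transvection γ} ≤
      stabSubgroup g (alphaV g o) := by
    rw [Subgroup.closure_le]
    rintro x ⟨γ, hγ, hx⟩
    change x.val *ᵥ _ = _
    rw [hx, transvection_mulVec, hγ]
    simp
  have tSp_mem (γ : Fin g ⊕ Fin g → ℤ) (hγ : sympForm γ (alphaV g o) = 0) :
      tSp γ ∈ Subgroup.closure {x : Matrix.symplecticGroup (Fin g) ℤ |
      ∃ γ, sympForm γ (alphaV g o) = 0 ∧ x.val = transvection γ} :=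
    Subgroup.subset_closure ⟨γ, hγ, rfl⟩
  have nSp_mem (u w : Fin g ⊕ Fin g → ℤ) (hu : sympForm u (alphaV g o) = 0)
      (hw : sympForm w (alphaV g o) = 0) :
      nSp u w ∈ Subgroup.closure {x : Matrix.symplecticGroup (Fin g) ℤ |
      ∃ γ, sympForm γ (alphaV g o) = 0 ∧ x.val = transvection γ} :=
    mul_mem (mul_mem (tSp_mem u hu) (tSp_mem w hw))
      (inv_mem (tSp_mem _ (by rw [sympForm_add_left, hu, hw, add_zero])))
  refine ⟨le_antisymm transv_le (stabSubgroup_alphaV_le ?_ ?_),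
    le_antisymm (stabSubgroup_alphaV_le ?_ ?_) ?_⟩
  · exact fun p hp => tSp_mem _ (form_single p hp)
  · exact fun p q hp hq _ _ => nSp_mem _ _ (form_single p hp) (form_single q hq)
  · rintro (i | i) hp
    · exact Subgroup.subset_closure (Or.inl ⟨i, rfl⟩)
    · exact Subgroup.subset_closure (Or.inr (Or.inl ⟨i, fun h => hp (h ▸ rfl), rfl⟩))
  · rintro (i | i) (j | j) hp hq hpq hqp
    · exact Subgroup.subset_closure (Or.inr (Or.inr (Or.inl
        ⟨i, j, fun h => hpq (h ▸ rfl), nSp_val _ _⟩)))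
    · exact Subgroup.subset_closure (Or.inr (Or.inr (Or.inr (Or.inr
        ⟨i, j, fun h => hqp (h ▸ rfl), fun h => hq (h ▸ rfl), nSp_val _ _⟩))))
    · rw [nSp_comm (sympForm_single_single hqp)]
      exact Subgroup.subset_closure (Or.inr (Or.inr (Or.inr (Or.inr
        ⟨j, i, fun h => hqp (h ▸ rfl), fun h => hp (h ▸ rfl), nSp_val _ _⟩))))
    · exact Subgroup.subset_closure (Or.inr (Or.inr (Or.inr (Or.inl
        ⟨i, j, fun h => hpq (h ▸ rfl), fun h => hp (h ▸ rfl), fun h => hq (h ▸ rfl),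
          nSp_val _ _⟩))))
  · have alpha (i : Fin g) : sympForm (alphaV g i) (alphaV g o) = 0 :=
      form_single (Sum.inl i) (by simp)
    have beta (i : Fin g) (hi : i ≠ o) : sympForm (betaV g i) (alphaV g o) = 0 :=
      form_single (Sum.inr i) (by simpa using hi)
    rw [Subgroup.closure_le]
    rintro x (⟨i, hx⟩ | ⟨i, hi, hx⟩ | ⟨i, j, -, hx⟩ | ⟨i, j, -, hi, hj, hx⟩ | ⟨i, j, -, hj, hx⟩)
    · rw [show x = tSp _ from Subtype.ext hx]
      exact transv_le (tSp_mem _ (alpha i))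
    · rw [show x = tSp _ from Subtype.ext hx]
      exact transv_le (tSp_mem _ (beta i hi))
    · rw [show x = nSp _ _ from Subtype.ext (hx.trans (nSp_val _ _).symm)]
      exact transv_le (nSp_mem _ _ (alpha i) (alpha j))
    · rw [show x = nSp _ _ from Subtype.ext (hx.trans (nSp_val _ _).symm)]
      exact transv_le (nSp_mem _ _ (beta i hi) (beta j hj))
    · rw [show x = nSp _ _ from Subtype.ext (hx.trans (nSp_val _ _).symm)]
      exact transv_le (nSp_mem _ _ (alpha i) (beta j hj))
end
end
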